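/- (Helicity conservation.) Let V : ℝ × ℝ³ → ℝ³ and h : ℝ × ℝ³ → ℝ be twice continuously differentiable and ℤ³-periodic in the space variable (V(t, x + k) = V(t,x) and h(t, x + k) = h(t,x) for all k ∈ ℤ³), and suppose the barotropic momentum equation ∂ₜV + (V·∇)V = −∇h holds at every (t,x). Then the helicity C(t) := ∫_{[0,1]³} ⟨V(t,x), curl V(t,x)⟩ dx is constant in t. -/

import Mathlib

open MeasureTheory

noncomputable section

/-- Points of ℝ³. -/
abbrev R3 := Fin 3 → ℝ

/-- Euclidean inner product on ℝ³. -/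
def dot3 (u v : R3) : ℝ := ∑ i, u i * v i

/-- Partial derivative ∂ᵢ of a scalar field on ℝ³. -/
def pd3 (i : Fin 3) (f : R3 → ℝ) (x : R3) : ℝ := fderiv ℝ f x (Pi.single i 1)

/-- Gradient of a scalar field on ℝ³. -/
def grad3 (f : R3 → ℝ) (x : R3) : R3 := fun i => pd3 i f x

/-- Divergence of a vector field on ℝ³. -/
def div3 (V : R3 → R3) (x : R3) : ℝ := ∑ i, pd3 i (fun y => V y i) x

/-- Curl of a vector field on ℝ³ (0-based indices). -/
def curl3 (V : R3 → R3) (x : R3) : R3 :=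
  ![pd3 1 (fun y => V y 2) x - pd3 2 (fun y => V y 1) x,
    pd3 2 (fun y => V y 0) x - pd3 0 (fun y => V y 2) x,
    pd3 0 (fun y => V y 1) x - pd3 1 (fun y => V y 0) x]

/-- Cross product on ℝ³. -/
def cross3 (u v : R3) : R3 :=
  ![u 1 * v 2 - u 2 * v 1, u 2 * v 0 - u 0 * v 2, u 0 * v 1 - u 1 * v 0]

/-- Determinant of the 3×3 matrix with columns u, v, w. -/
def det3 (u v w : R3) : ℝ := Matrix.det (Matrix.transpose (Matrix.of ![u, v, w]))

/-- Derivative of a scalar field in the constant direction `a`. -/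
def dirDeriv {E : Type*} [NormedAddCommGroup E] [NormedSpace ℝ E] (a : E) (f : E → ℝ) (p : E) : ℝ :=
  fderiv ℝ f p a

section dirDeriv

variable {E : Type*} [NormedAddCommGroup E] [NormedSpace ℝ E] {f g : E → ℝ}

theorem dirDeriv_add (hf : Differentiable ℝ f) (hg : Differentiable ℝ g) (a p : E) :
    dirDeriv a (fun q => f q + g q) p = dirDeriv a f p + dirDeriv a g p := by
  simp [dirDeriv, fderiv_fun_add (hf p) (hg p)]

theorem dirDeriv_sub (hf : Differentiable ℝ f) (hg : Differentiable ℝ g) (a p : E) :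
    dirDeriv a (fun q => f q - g q) p = dirDeriv a f p - dirDeriv a g p := by
  simp [dirDeriv, fderiv_fun_sub (hf p) (hg p)]

theorem dirDeriv_mul (hf : Differentiable ℝ f) (hg : Differentiable ℝ g) (a p : E) :
    dirDeriv a (fun q => f q * g q) p = dirDeriv a f p * g p + f p * dirDeriv a g p := by
  simp [dirDeriv, fderiv_fun_mul (hf p) (hg p)]
  ring

theorem dirDeriv_const_mul (hf : Differentiable ℝ f) (c : ℝ) (a p : E) :
    dirDeriv a (fun q => c * f q) p = c * dirDeriv a f p := by
  simp [dirDeriv, fderiv_const_mul (hf p)]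

theorem contDiff_dirDeriv (hf : ContDiff ℝ 2 f) (a : E) : ContDiff ℝ 1 (dirDeriv a f) :=
  (hf.fderiv_right (m := 1) (by norm_num)).clm_apply contDiff_const

theorem continuous_dirDeriv (hf : ContDiff ℝ 1 f) (a : E) : Continuous (dirDeriv a f) :=
  (hf.continuous_fderiv one_ne_zero).clm_apply continuous_const

theorem dirDeriv_comm (hf : ContDiff ℝ 2 f) (a b p : E) :
    dirDeriv a (dirDeriv b f) p = dirDeriv b (dirDeriv a f) p := by
  have hd : Differentiable ℝ (fderiv ℝ f) :=
    (hf.fderiv_right (m := 1) (by norm_num)).differentiable one_ne_zero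
  have key : ∀ a b : E, dirDeriv a (dirDeriv b f) p = fderiv ℝ (fderiv ℝ f) p a b := by
    intro a b
    have := (hd p).hasFDerivAt.clm_apply (hasFDerivAt_const b p)
    have h2 : fderiv ℝ (fun q => fderiv ℝ f q b) p = _ := this.fderiv
    change fderiv ℝ (fun q => fderiv ℝ f q b) p a = _
    rw [h2]
    simp
  rw [key, key]
  exact (hf.contDiffAt.isSymmSndFDerivAt (by simp)) a b

theorem dirDeriv_periodic {c : E} (hf : ∀ p, f (p + c) = f p) (a p : E) :
    dirDeriv a f (p + c) = dirDeriv a f p := by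
  unfold dirDeriv
  rw [← fderiv_comp_add_right]
  simp only [hf]

end dirDeriv

/-- The unit time direction in `ℝ × ℝ³`. -/
def timeDir : ℝ × R3 := (1, 0)

/-- The `i`-th unit space direction in `ℝ × ℝ³`. -/
def spaceDir (i : Fin 3) : ℝ × R3 := (0, Pi.single i 1)

theorem hasFDerivAt_slice {f : ℝ × R3 → ℝ} (hf : Differentiable ℝ f) (t : ℝ) (x : R3) :
    HasFDerivAt (fun y => f (t, y))
      ((fderiv ℝ f (t, x)).comp (ContinuousLinearMap.inr ℝ ℝ R3)) x :=
  (hf (t, x)).hasFDerivAt.comp x (hasFDerivAt_prodMk_right t x)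

theorem pd3_slice {f : ℝ × R3 → ℝ} (hf : Differentiable ℝ f) (i : Fin 3) (t : ℝ) (x : R3) :
    pd3 i (fun y => f (t, y)) x = dirDeriv (spaceDir i) f (t, x) := by
  simp [pd3, (hasFDerivAt_slice hf t x).fderiv, dirDeriv, spaceDir]

theorem hasDerivAt_slice {f : ℝ × R3 → ℝ} (hf : Differentiable ℝ f) (t : ℝ) (x : R3) :
    HasDerivAt (fun s => f (s, x)) (dirDeriv timeDir f (t, x)) t := by
  have := ((hf (t, x)).hasFDerivAt.comp t (hasFDerivAt_prodMk_left t x)).hasDerivAt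
  convert! this using 1

/-- The space divergence of a periodic `C¹` field integrates to zero over the unit cell. -/
theorem integral_divergence_eq_zero_of_periodic (F : Fin 3 → ℝ × R3 → ℝ)
    (hF : ∀ i, ContDiff ℝ 1 (F i))
    (hper : ∀ i (k : Fin 3 → ℤ) p, F i (p + (0, fun j => (k j : ℝ))) = F i p) (t : ℝ) :
    ∫ x in Set.Icc (0 : R3) 1, ∑ i, dirDeriv (spaceDir i) (F i) (t, x) = 0 := by
  have hd : ∀ i, Differentiable ℝ (F i) := fun i => (hF i).differentiable one_ne_zero
  have hcont : Continuous fun x : R3 => ∑ i, dirDeriv (spaceDir i) (F i) (t, x) :=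
    continuous_finsetSum _ fun i _ =>
      (continuous_dirDeriv (hF i) _).comp (Continuous.prodMk_right t)
  have key := integral_divergence_of_hasFDerivAt_off_countable' (0 : R3) 1 zero_le_one
    (fun i x => F i (t, x))
    (fun i x => (fderiv ℝ (F i) (t, x)).comp (ContinuousLinearMap.inr ℝ ℝ R3))
    ∅ Set.countable_empty
    (fun i => ((hF i).continuous.comp (Continuous.prodMk_right t)).continuousOn)
    (fun x _ i => hasFDerivAt_slice (hd i) t x)
    (by simpa [dirDeriv, spaceDir] using hcont.continuousOn.integrableOn_compact isCompact_Icc)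
  have hlhs : ∀ x : R3, ∑ i, dirDeriv (spaceDir i) (F i) (t, x) =
      ∑ i, ((fderiv ℝ (F i) (t, x)).comp (ContinuousLinearMap.inr ℝ ℝ R3)) (Pi.single i 1) := by
    intro x
    simp [dirDeriv, spaceDir]
  simp only [hlhs]
  rw [key]
  refine Finset.sum_eq_zero fun i _ => sub_eq_zero.2 ?_
  congr 1
  funext y
  rw [← hper i (Pi.single i 1) (t, i.insertNth ((0 : R3) i) y)]
  congr 1
  refine Prod.ext (by simp) ?_
  funext j
  refine Fin.succAboveCases i ?_ (fun j => ?_) j <;> simp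

/-- Differentiation under the integral sign over the unit cell. -/
theorem hasDerivAt_integral_unitCell {G : ℝ × R3 → ℝ} (hG : ContDiff ℝ 1 G) (t : ℝ) :
    HasDerivAt (fun s => ∫ x in Set.Icc (0 : R3) 1, G (s, x))
      (∫ x in Set.Icc (0 : R3) 1, dirDeriv timeDir G (t, x)) t := by
  have hcont := continuous_dirDeriv hG timeDir
  obtain ⟨C, hC⟩ := ((isCompact_Icc (a := t - 1) (b := t + 1)).prod
    (isCompact_Icc (a := (0 : R3)) (b := 1))).exists_bound_of_continuousOn hcont.continuousOn
  have hslice : ∀ {g : ℝ × R3 → ℝ}, Continuous g → ∀ s,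
      IntegrableOn (fun x => g (s, x)) (Set.Icc (0 : R3) 1) := fun hg s =>
    (hg.comp (Continuous.prodMk_right s)).continuousOn.integrableOn_compact isCompact_Icc
  refine (hasDerivAt_integral_of_dominated_loc_of_deriv_le (bound := fun _ => C)
    (F' := fun s x => dirDeriv timeDir G (s, x))
    (Icc_mem_nhds (sub_one_lt t) (lt_add_one t))
    (Filter.Eventually.of_forall fun s => (hslice hG.continuous s).aestronglyMeasurable)
    (hslice hG.continuous t) (hslice hcont t).aestronglyMeasurable ?_ ?_ ?_).2
  · exact (ae_restrict_iff' measurableSet_Icc).2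
      (Filter.Eventually.of_forall fun x hx s hs => hC (s, x) ⟨hs, hx⟩)
  · exact continuousOn_const.integrableOn_compact isCompact_Icc
  · exact Filter.Eventually.of_forall fun x s _ =>
      hasDerivAt_slice (hG.differentiable one_ne_zero) s x

/-- The `i`-th component of the curl in the space variable (indices mod 3). -/
def vorticity (v : Fin 3 → ℝ × R3 → ℝ) (i : Fin 3) (p : ℝ × R3) : ℝ :=
  dirDeriv (spaceDir (i + 1)) (v (i + 2)) p - dirDeriv (spaceDir (i + 2)) (v (i + 1)) p

/-- The helicity density `⟨v, curl v⟩`. -/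
def helicityDensity (v : Fin 3 → ℝ × R3 → ℝ) (p : ℝ × R3) : ℝ :=
  v 0 p * vorticity v 0 p + v 1 p * vorticity v 1 p + v 2 p * vorticity v 2 p

/-- The Bernoulli function `h + |v|² / 2`. -/
def bernoulliHead (v : Fin 3 → ℝ × R3 → ℝ) (h : ℝ × R3 → ℝ) (p : ℝ × R3) : ℝ :=
  h p + 1 / 2 * (v 0 p * v 0 p + v 1 p * v 1 p + v 2 p * v 2 p)

/-- The field `∂ₜv × v - 2 (h + |v|² / 2) curl v`, whose divergence is the time derivative of the
helicity density of a barotropic flow. -/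
def helicityFlux (v : Fin 3 → ℝ × R3 → ℝ) (h : ℝ × R3 → ℝ) (i : Fin 3) (p : ℝ × R3) : ℝ :=
  dirDeriv timeDir (v (i + 1)) p * v (i + 2) p - dirDeriv timeDir (v (i + 2)) p * v (i + 1) p
    - 2 * (bernoulliHead v h p * vorticity v i p)

section helicity

variable {v : Fin 3 → ℝ × R3 → ℝ} {h : ℝ × R3 → ℝ}

theorem contDiff_vorticity (hv : ∀ i, ContDiff ℝ 2 (v i)) (i : Fin 3) :
    ContDiff ℝ 1 (vorticity v i) :=
  (contDiff_dirDeriv (hv _) _).sub (contDiff_dirDeriv (hv _) _)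

theorem contDiff_bernoulliHead (hv : ∀ i, ContDiff ℝ 2 (v i)) (hh : ContDiff ℝ 2 h) :
    ContDiff ℝ 2 (bernoulliHead v h) :=
  hh.add (contDiff_const.mul
    ((((hv 0).mul (hv 0)).add ((hv 1).mul (hv 1))).add ((hv 2).mul (hv 2))))

theorem contDiff_helicityDensity (hv : ∀ i, ContDiff ℝ 2 (v i)) :
    ContDiff ℝ 1 (helicityDensity v) := by
  have h1 : ∀ i, ContDiff ℝ 1 (v i) := fun i => (hv i).of_le one_le_two
  have hw := contDiff_vorticity hv
  exact (((h1 0).mul (hw 0)).add ((h1 1).mul (hw 1))).add ((h1 2).mul (hw 2))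

theorem contDiff_helicityFlux (hv : ∀ i, ContDiff ℝ 2 (v i)) (hh : ContDiff ℝ 2 h) (i : Fin 3) :
    ContDiff ℝ 1 (helicityFlux v h i) := by
  have h1 : ∀ i, ContDiff ℝ 1 (v i) := fun i => (hv i).of_le one_le_two
  have ht : ∀ i, ContDiff ℝ 1 (dirDeriv timeDir (v i)) := fun i => contDiff_dirDeriv (hv i) _
  exact (((ht _).mul (h1 _)).sub ((ht _).mul (h1 _))).sub
    (contDiff_const.mul (((contDiff_bernoulliHead hv hh).of_le one_le_two).mul
      (contDiff_vorticity hv i)))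

theorem helicityFlux_periodic {c : ℝ × R3} (hv : ∀ i p, v i (p + c) = v i p)
    (hh : ∀ p, h (p + c) = h p) (i : Fin 3) (p : ℝ × R3) :
    helicityFlux v h i (p + c) = helicityFlux v h i p := by
  simp only [helicityFlux, bernoulliHead, vorticity, hv, hh, dirDeriv_periodic (hv _)]

theorem dirDeriv_bernoulliHead (hv : ∀ i, ContDiff ℝ 2 (v i)) (hh : ContDiff ℝ 2 h)
    (a p : ℝ × R3) :
    dirDeriv a (bernoulliHead v h) p = dirDeriv a h p
      + (v 0 p * dirDeriv a (v 0) p + v 1 p * dirDeriv a (v 1) p + v 2 p * dirDeriv a (v 2) p) := by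
  have hd : ∀ i, Differentiable ℝ (v i) := fun i => (hv i).differentiable two_ne_zero
  have hm : ∀ i, Differentiable ℝ (fun q => v i q * v i q) := fun i => (hd i).mul (hd i)
  have hs : Differentiable ℝ (fun q => v 0 q * v 0 q + v 1 q * v 1 q) := (hm 0).add (hm 1)
  have hs' : Differentiable ℝ (fun q => v 0 q * v 0 q + v 1 q * v 1 q + v 2 q * v 2 q) :=
    hs.add (hm 2)
  unfold bernoulliHead
  rw [dirDeriv_add (hh.differentiable two_ne_zero) (hs'.const_mul _), dirDeriv_const_mul hs',
    dirDeriv_add hs (hm 2), dirDeriv_add (hm 0) (hm 1)]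
  simp only [dirDeriv_mul (hd _) (hd _)]
  ring

theorem dirDeriv_vorticity (hv : ∀ i, ContDiff ℝ 2 (v i)) (a : ℝ × R3) (i : Fin 3) (p : ℝ × R3) :
    dirDeriv a (vorticity v i) p = dirDeriv (spaceDir (i + 1)) (dirDeriv a (v (i + 2))) p
      - dirDeriv (spaceDir (i + 2)) (dirDeriv a (v (i + 1))) p := by
  have hd : ∀ i b, Differentiable ℝ (dirDeriv b (v i)) := fun i b =>
    (contDiff_dirDeriv (hv i) b).differentiable one_ne_zero
  unfold vorticity
  rw [dirDeriv_sub (hd _ _) (hd _ _), dirDeriv_comm (hv _), dirDeriv_comm (hv _) a]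

theorem dirDeriv_helicityDensity (hv : ∀ i, ContDiff ℝ 2 (v i)) (a p : ℝ × R3) :
    dirDeriv a (helicityDensity v) p =
      dirDeriv a (v 0) p * vorticity v 0 p + v 0 p * dirDeriv a (vorticity v 0) p
      + (dirDeriv a (v 1) p * vorticity v 1 p + v 1 p * dirDeriv a (vorticity v 1) p)
      + (dirDeriv a (v 2) p * vorticity v 2 p + v 2 p * dirDeriv a (vorticity v 2) p) := by
  have hd : ∀ i, Differentiable ℝ (v i) := fun i => (hv i).differentiable two_ne_zero
  have hw : ∀ i, Differentiable ℝ (vorticity v i) := fun i =>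
    (contDiff_vorticity hv i).differentiable one_ne_zero
  have hm : ∀ i, Differentiable ℝ (fun q => v i q * vorticity v i q) :=
    fun i => (hd i).mul (hw i)
  have hs : Differentiable ℝ (fun q => v 0 q * vorticity v 0 q + v 1 q * vorticity v 1 q) :=
    (hm 0).add (hm 1)
  unfold helicityDensity
  rw [dirDeriv_add hs (hm 2), dirDeriv_add (hm 0) (hm 1)]
  simp only [dirDeriv_mul (hd _) (hw _)]

theorem dirDeriv_helicityFlux (hv : ∀ i, ContDiff ℝ 2 (v i)) (hh : ContDiff ℝ 2 h)
    (a : ℝ × R3) (i : Fin 3) (p : ℝ × R3) :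
    dirDeriv a (helicityFlux v h i) p =
      dirDeriv a (dirDeriv timeDir (v (i + 1))) p * v (i + 2) p
      + dirDeriv timeDir (v (i + 1)) p * dirDeriv a (v (i + 2)) p
      - (dirDeriv a (dirDeriv timeDir (v (i + 2))) p * v (i + 1) p
        + dirDeriv timeDir (v (i + 2)) p * dirDeriv a (v (i + 1)) p)
      - 2 * (dirDeriv a (bernoulliHead v h) p * vorticity v i p
        + bernoulliHead v h p * dirDeriv a (vorticity v i) p) := by
  have hd : ∀ i, Differentiable ℝ (v i) := fun i => (hv i).differentiable two_ne_zero
  have hw : Differentiable ℝ (vorticity v i) :=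
    (contDiff_vorticity hv i).differentiable one_ne_zero
  have ht : ∀ i, Differentiable ℝ (dirDeriv timeDir (v i)) := fun i =>
    (contDiff_dirDeriv (hv i) _).differentiable one_ne_zero
  have hb : Differentiable ℝ (bernoulliHead v h) :=
    (contDiff_bernoulliHead hv hh).differentiable two_ne_zero
  have hm : ∀ i j, Differentiable ℝ (fun q => dirDeriv timeDir (v i) q * v j q) :=
    fun i j => (ht i).mul (hd j)
  have hc : Differentiable ℝ (fun q => dirDeriv timeDir (v (i + 1)) q * v (i + 2) q
      - dirDeriv timeDir (v (i + 2)) q * v (i + 1) q) := (hm _ _).sub (hm _ _)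
  have hbw : Differentiable ℝ (fun q => bernoulliHead v h q * vorticity v i q) := hb.mul hw
  unfold helicityFlux
  rw [dirDeriv_sub hc (hbw.const_mul 2), dirDeriv_sub (hm _ _) (hm _ _),
    dirDeriv_const_mul hbw, dirDeriv_mul hb hw]
  simp only [dirDeriv_mul (ht _) (hd _)]

/-- Local helicity balance of a barotropic flow. -/
theorem dirDeriv_time_helicityDensity (hv : ∀ i, ContDiff ℝ 2 (v i)) (hh : ContDiff ℝ 2 h)
    (p : ℝ × R3)
    (hmom : ∀ i, dirDeriv timeDir (v i) p + ∑ j, v j p * dirDeriv (spaceDir j) (v i) p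
      = -dirDeriv (spaceDir i) h p) :
    dirDeriv timeDir (helicityDensity v) p =
      ∑ i, dirDeriv (spaceDir i) (helicityFlux v h i) p := by
  have m0 := hmom 0
  have m1 := hmom 1
  have m2 := hmom 2
  have e1 : (1 + 1 : Fin 3) = 2 := rfl
  have e2 : (1 + 2 : Fin 3) = 0 := rfl
  have e3 : (2 + 1 : Fin 3) = 0 := rfl
  have e4 : (2 + 2 : Fin 3) = 1 := rfl
  simp only [Fin.sum_univ_three] at m0 m1 m2 ⊢
  rw [dirDeriv_helicityDensity hv]
  simp only [dirDeriv_helicityFlux hv hh, dirDeriv_bernoulliHead hv hh, dirDeriv_vorticity hv]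
  simp only [vorticity, zero_add, e1, e2, e3, e4]
  rw [dirDeriv_comm (hv 1) (spaceDir 2) (spaceDir 0), dirDeriv_comm (hv 2) (spaceDir 1) (spaceDir 0),
    dirDeriv_comm (hv 0) (spaceDir 2) (spaceDir 1)]
  rw [eq_neg_iff_add_eq_zero] at m0 m1 m2
  linear_combination
    2 * (dirDeriv (spaceDir 1) (v 2) p - dirDeriv (spaceDir 2) (v 1) p) * m0
    + 2 * (dirDeriv (spaceDir 2) (v 0) p - dirDeriv (spaceDir 0) (v 2) p) * m1
    + 2 * (dirDeriv (spaceDir 0) (v 1) p - dirDeriv (spaceDir 1) (v 0) p) * m2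

end helicity

/-- helicity conservation for barotropic flow on the 3-torus:
C(t) = ∫_{[0,1]³} ⟨V, curl V⟩ is constant in time. -/
theorem helicity_conservation (V : ℝ × R3 → R3) (h : ℝ × R3 → ℝ)
    (hV : ContDiff ℝ 2 V) (hh : ContDiff ℝ 2 h)
    (hVper : ∀ (t : ℝ) (x : R3) (k : Fin 3 → ℤ), V (t, x + fun i => (k i : ℝ)) = V (t, x))
    (hhper : ∀ (t : ℝ) (x : R3) (k : Fin 3 → ℤ), h (t, x + fun i => (k i : ℝ)) = h (t, x))
    (hmom : ∀ (t : ℝ) (x : R3),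
      deriv (fun s => V (s, x)) t
        + (fun i => dot3 (V (t, x)) (grad3 (fun y => V (t, y) i) x))
        = -grad3 (fun y => h (t, y)) x) :
    ∀ t₁ t₂ : ℝ,
      (∫ x in Set.Icc (0 : R3) 1, dot3 (V (t₁, x)) (curl3 (fun y => V (t₁, y)) x))
        = ∫ x in Set.Icc (0 : R3) 1, dot3 (V (t₂, x)) (curl3 (fun y => V (t₂, y)) x) := by
  have hv : ∀ i, ContDiff ℝ 2 (fun p => V p i) := fun i => contDiff_pi.1 hV i
  have hd : ∀ i, Differentiable ℝ (fun p => V p i) := fun i => (hv i).differentiable two_ne_zero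
  have hdens : ∀ t x, dot3 (V (t, x)) (curl3 (fun y => V (t, y)) x)
      = helicityDensity (fun i p => V p i) (t, x) := by
    intro t x
    simp only [dot3, curl3, Fin.sum_univ_three, pd3_slice (hd _)]
    rfl
  have hbalance : ∀ p, dirDeriv timeDir (helicityDensity fun i p => V p i) p =
      ∑ i, dirDeriv (spaceDir i) (helicityFlux (fun i p => V p i) h i) p := by
    rintro ⟨t, x⟩
    refine dirDeriv_time_helicityDensity hv hh _ fun i => ?_
    have hderiv := (hasDerivAt_pi.2 fun i => hasDerivAt_slice (hd i) t x).deriv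
    have := congrFun (hmom t x) i
    rw [hderiv] at this
    simpa [dot3, grad3, pd3_slice (hd _), pd3_slice (hh.differentiable two_ne_zero)] using this
  have hzero : ∀ t, ∫ x in Set.Icc (0 : R3) 1,
      dirDeriv timeDir (helicityDensity fun i p => V p i) (t, x) = 0 := by
    intro t
    simp only [hbalance]
    refine integral_divergence_eq_zero_of_periodic _ (contDiff_helicityFlux hv hh)
      (fun i k p => helicityFlux_periodic (fun i p => ?_) (fun p => ?_) i p) t
    · simpa [Prod.add_def] using congrFun (hVper p.1 p.2 k) i
    · simpa [Prod.add_def] using hhper p.1 p.2 k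
  have hder := hasDerivAt_integral_unitCell (contDiff_helicityDensity hv)
  simp only [hdens]
  exact is_const_of_deriv_eq_zero (fun t => (hder t).differentiableAt)
    fun t => (hder t).deriv.trans (hzero t)
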